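/- Let n ≥ 2, m ≥ 3, and let B_1, …, B_m be n×n complex Hermitian matrices. Then equality Σ_{r,s=1}^m ‖[B_r, B_s]‖² = (4/3)(Σ_{r=1}^m ‖B_r‖²)² holds if and only if there exist a unitary matrix P ∈ U(n), an orthogonal matrix R ∈ O(m), a real number λ ≥ 0, and three distinct indices r_1, r_2, r_3 ∈ {1,…,m} such that the matrices C_r := Σ_{j=1}^m R_{j r} P* B_j P satisfy: C_{r_1} = diag(H_1, 0), C_{r_2} = diag(H_2, 0), C_{r_3} = diag(H_3, 0) (each a block-diagonal n×n matrix with lower-right (n−2)×(n−2) zero block), and C_r = 0 for every other index r. -/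

import Mathlib

open Matrix

/-- Squared Frobenius norm of a complex matrix: `Re tr (A Aᴴ)`. -/
noncomputable def frobSq {n : ℕ} (A : Matrix (Fin n) (Fin n) ℂ) : ℝ :=
  ((A * Aᴴ).trace).re

/-- Commutator of matrices. -/
noncomputable def mcomm {n : ℕ} (A B : Matrix (Fin n) (Fin n) ℂ) : Matrix (Fin n) (Fin n) ℂ :=
  A * B - B * A

/-- `H₁ = [[λ,0],[0,-λ]]`. -/
noncomputable def H1 (l : ℝ) : Matrix (Fin 2) (Fin 2) ℂ := !![(l : ℂ), 0; 0, -(l : ℂ)]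

/-- `H₂ = [[0,λ],[λ,0]]`. -/
noncomputable def H2 (l : ℝ) : Matrix (Fin 2) (Fin 2) ℂ := !![0, (l : ℂ); (l : ℂ), 0]

/-- `H₃ = [[0,-λi],[λi,0]]`. -/
noncomputable def H3 (l : ℝ) : Matrix (Fin 2) (Fin 2) ℂ :=
  !![0, -(l : ℂ) * Complex.I; (l : ℂ) * Complex.I, 0]

/-- The block-diagonal `n × n` matrix `diag(M, 0)` with lower-right `(n-2) × (n-2)` zero block. -/
def diagEmbed {n : ℕ} (M : Matrix (Fin 2) (Fin 2) ℂ) : Matrix (Fin n) (Fin n) ℂ :=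
  fun i j => if h : i.val < 2 ∧ j.val < 2 then M ⟨i.val, h.1⟩ ⟨j.val, h.2⟩ else 0

/-- Real Frobenius inner product of complex matrices. -/
noncomputable def frobInner {n : ℕ} (A B : Matrix (Fin n) (Fin n) ℂ) : ℝ :=
  ((A * Bᴴ).trace).re

lemma frobSq_eq_sum {n : ℕ} (A : Matrix (Fin n) (Fin n) ℂ) :
    frobSq A = ∑ i, ∑ j, Complex.normSq (A i j) := by
  simp [frobSq, Matrix.trace, Matrix.mul_apply, Complex.mul_conj, ← Complex.ofReal_sum]

lemma normSq_apply_le_frobSq {n : ℕ} (A : Matrix (Fin n) (Fin n) ℂ) (i j : Fin n) :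
    Complex.normSq (A i j) ≤ frobSq A := by
  rw [frobSq_eq_sum]
  calc Complex.normSq (A i j) ≤ ∑ j, Complex.normSq (A i j) :=
        Finset.single_le_sum (f := fun j => Complex.normSq (A i j))
          (fun j _ => Complex.normSq_nonneg _) (Finset.mem_univ j)
    _ ≤ _ := Finset.single_le_sum (f := fun i => ∑ j, Complex.normSq (A i j))
          (fun i _ => Finset.sum_nonneg fun j _ => Complex.normSq_nonneg _) (Finset.mem_univ i)

lemma frobSq_nonneg {n : ℕ} (A : Matrix (Fin n) (Fin n) ℂ) : 0 ≤ frobSq A := by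
  rw [frobSq_eq_sum]
  exact Finset.sum_nonneg fun i _ => Finset.sum_nonneg fun j _ => Complex.normSq_nonneg _

lemma frobSq_eq_zero {n : ℕ} {A : Matrix (Fin n) (Fin n) ℂ} (h : frobSq A = 0) : A = 0 := by
  ext i j
  have := normSq_apply_le_frobSq A i j
  rw [h] at this
  exact Complex.normSq_eq_zero.1 (le_antisymm this (Complex.normSq_nonneg _))

@[simp] lemma frobSq_zero {n : ℕ} : frobSq (0 : Matrix (Fin n) (Fin n) ℂ) = 0 := by
  simp [frobSq]

/-- In a Hermitian matrix each off-diagonal entry is counted twice by the squared norm. -/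
lemma two_mul_normSq_apply_le_frobSq {n : ℕ} {A : Matrix (Fin n) (Fin n) ℂ} (hA : Aᴴ = A)
    {i j : Fin n} (hij : i ≠ j) : 2 * Complex.normSq (A i j) ≤ frobSq A := by
  have hji : Complex.normSq (A j i) = Complex.normSq (A i j) := by
    conv_lhs => rw [← hA]
    simp
  have hrow : ∀ k l, Complex.normSq (A k l) ≤ ∑ l, Complex.normSq (A k l) := fun k l =>
    Finset.single_le_sum (f := fun l => Complex.normSq (A k l))
      (fun _ _ => Complex.normSq_nonneg _) (Finset.mem_univ l)
  rw [frobSq_eq_sum]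
  calc 2 * Complex.normSq (A i j) = Complex.normSq (A i j) + Complex.normSq (A j i) := by
        rw [hji]; ring
    _ ≤ (∑ l, Complex.normSq (A i l)) + ∑ l, Complex.normSq (A j l) :=
        add_le_add (hrow i j) (hrow j i)
    _ = ∑ k ∈ {i, j}, ∑ l, Complex.normSq (A k l) := by rw [Finset.sum_pair hij]
    _ ≤ _ := Finset.sum_le_sum_of_subset_of_nonneg (Finset.subset_univ _)
        fun k _ _ => Finset.sum_nonneg fun l _ => Complex.normSq_nonneg _

lemma frobInner_comm {n : ℕ} (A B : Matrix (Fin n) (Fin n) ℂ) :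
    frobInner A B = frobInner B A := by
  have : A * Bᴴ = (B * Aᴴ)ᴴ := by simp
  rw [frobInner, this, Matrix.trace_conjTranspose]
  simp [frobInner]

lemma frobInner_sum_smul_left {n : ℕ} {ι : Type*} (S : Finset ι) (c : ι → ℝ)
    (X : ι → Matrix (Fin n) (Fin n) ℂ) (Y : Matrix (Fin n) (Fin n) ℂ) :
    frobInner (∑ s ∈ S, (c s : ℂ) • X s) Y = ∑ s ∈ S, c s * frobInner (X s) Y := by
  simp [frobInner, Finset.sum_mul, Matrix.trace_sum, Matrix.trace_smul]

lemma frobInner_sum_smul_right {n : ℕ} {ι : Type*} (S : Finset ι) (c : ι → ℝ)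
    (X : ι → Matrix (Fin n) (Fin n) ℂ) (Y : Matrix (Fin n) (Fin n) ℂ) :
    frobInner Y (∑ s ∈ S, (c s : ℂ) • X s) = ∑ s ∈ S, c s * frobInner Y (X s) := by
  rw [frobInner_comm, frobInner_sum_smul_left]
  simp_rw [frobInner_comm]

lemma frobInner_conj {n : ℕ} {U : Matrix (Fin n) (Fin n) ℂ} (hU : Uᴴ * U = 1)
    (A B : Matrix (Fin n) (Fin n) ℂ) :
    frobInner (Uᴴ * A * U) (Uᴴ * B * U) = frobInner A B := by
  have hU' : U * Uᴴ = 1 := mul_eq_one_comm.1 hU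
  have : Uᴴ * A * U * (Uᴴ * B * U)ᴴ = Uᴴ * (A * Bᴴ * U) := by
    simp only [Matrix.conjTranspose_mul, Matrix.conjTranspose_conjTranspose, Matrix.mul_assoc]
    rw [← Matrix.mul_assoc U Uᴴ, hU', Matrix.one_mul]
  rw [frobInner, this, Matrix.trace_mul_comm, Matrix.mul_assoc, hU', Matrix.mul_one, frobInner]

lemma frobSq_conj {n : ℕ} {U : Matrix (Fin n) (Fin n) ℂ} (hU : Uᴴ * U = 1)
    (A : Matrix (Fin n) (Fin n) ℂ) : frobSq (Uᴴ * A * U) = frobSq A :=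
  frobInner_conj hU A A

lemma mcomm_conj {n : ℕ} {U : Matrix (Fin n) (Fin n) ℂ} (hU : Uᴴ * U = 1)
    (A B : Matrix (Fin n) (Fin n) ℂ) :
    mcomm (Uᴴ * A * U) (Uᴴ * B * U) = Uᴴ * mcomm A B * U := by
  have hU' : U * Uᴴ = 1 := mul_eq_one_comm.1 hU
  have : ∀ A B : Matrix (Fin n) (Fin n) ℂ, Uᴴ * A * U * (Uᴴ * B * U) = Uᴴ * (A * B) * U := by
    intro A B
    simp only [Matrix.mul_assoc]
    rw [← Matrix.mul_assoc U Uᴴ, hU', Matrix.one_mul]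
  rw [mcomm, this, this, mcomm, Matrix.mul_sub, Matrix.sub_mul]

lemma mcomm_sum_smul_left {n : ℕ} {ι : Type*} (S : Finset ι) (c : ι → ℂ)
    (X : ι → Matrix (Fin n) (Fin n) ℂ) (Y : Matrix (Fin n) (Fin n) ℂ) :
    mcomm (∑ s ∈ S, c s • X s) Y = ∑ s ∈ S, c s • mcomm (X s) Y := by
  simp [mcomm, Finset.sum_mul, Finset.mul_sum, smul_sub]

lemma mcomm_sum_smul_right {n : ℕ} {ι : Type*} (S : Finset ι) (c : ι → ℂ)
    (X : ι → Matrix (Fin n) (Fin n) ℂ) (Y : Matrix (Fin n) (Fin n) ℂ) :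
    mcomm Y (∑ s ∈ S, c s • X s) = ∑ s ∈ S, c s • mcomm Y (X s) := by
  simp [mcomm, Finset.sum_mul, Finset.mul_sum, smul_sub]

lemma frobSq_mcomm_comm {n : ℕ} (A B : Matrix (Fin n) (Fin n) ℂ) :
    frobSq (mcomm A B) = frobSq (mcomm B A) := by
  have : mcomm A B = -mcomm B A := by simp [mcomm]
  rw [this]
  simp [frobSq]

lemma mcomm_self {n : ℕ} (A : Matrix (Fin n) (Fin n) ℂ) : mcomm A A = 0 := sub_self _

/-- An orthogonal change of a finite family preserves the sum of the squared norms. -/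
lemma sum_frobSq_orthogonal {n m : ℕ} {R : Matrix (Fin m) (Fin m) ℝ} (hR : Rᵀ * R = 1)
    (X : Fin m → Matrix (Fin n) (Fin n) ℂ) :
    ∑ r, frobSq (∑ j, (R j r : ℂ) • X j) = ∑ j, frobSq (X j) := by
  have hR' : R * Rᵀ = 1 := mul_eq_one_comm.1 hR
  have h : ∀ j k, ∑ r, R j r * R k r = if j = k then 1 else 0 := by
    intro j k
    have := congrFun (congrFun hR' j) k
    simpa [Matrix.mul_apply, Matrix.one_apply] using this
  have h1 : ∀ r, frobSq (∑ j, (R j r : ℂ) • X j) =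
      ∑ j, ∑ k, (R j r * R k r) * frobInner (X j) (X k) := by
    intro r
    change frobInner _ _ = _
    rw [frobInner_sum_smul_left]
    refine Finset.sum_congr rfl fun j _ => ?_
    rw [frobInner_sum_smul_right, Finset.mul_sum]
    exact Finset.sum_congr rfl fun k _ => by ring
  simp_rw [h1]
  rw [Finset.sum_comm]
  refine Finset.sum_congr rfl fun j _ => ?_
  rw [Finset.sum_comm]
  simp_rw [← Finset.sum_mul, h]
  simp [frobInner, frobSq]

lemma sum_frobSq_mcomm_orthogonal {n m : ℕ} {R : Matrix (Fin m) (Fin m) ℝ} (hR : Rᵀ * R = 1)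
    (X : Fin m → Matrix (Fin n) (Fin n) ℂ) :
    ∑ r, ∑ s, frobSq (mcomm (∑ j, (R j r : ℂ) • X j) (∑ j, (R j s : ℂ) • X j)) =
      ∑ j, ∑ k, frobSq (mcomm (X j) (X k)) := by
  simp_rw [mcomm_sum_smul_right, sum_frobSq_orthogonal hR]
  rw [Finset.sum_comm]
  simp_rw [mcomm_sum_smul_left, sum_frobSq_orthogonal hR]
  rw [Finset.sum_comm]

lemma exists_unitary_diagonal {𝕜 : Type*} [RCLike 𝕜] {n : ℕ} {A : Matrix (Fin n) (Fin n) 𝕜}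
    (hA : Aᴴ = A) : ∃ (U : Matrix (Fin n) (Fin n) 𝕜) (a : Fin n → ℝ), Uᴴ * U = 1 ∧
      Uᴴ * A * U = diagonal fun i => (a i : 𝕜) := by
  have hA' : A.IsHermitian := hA
  refine ⟨hA'.eigenvectorUnitary, hA'.eigenvalues, ?_, ?_⟩
  · exact Unitary.coe_star_mul_self hA'.eigenvectorUnitary
  · have := hA'.conjStarAlgAut_star_eigenvectorUnitary
    rw [Unitary.conjStarAlgAut_star_apply] at this
    exact this

lemma frobSq_diagonal {n : ℕ} (a : Fin n → ℝ) :
    frobSq (diagonal fun i => (a i : ℂ)) = ∑ i, a i ^ 2 := by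
  simp [frobSq, sq]

lemma frobSq_mcomm_diagonal {n : ℕ} (a : Fin n → ℝ) (X : Matrix (Fin n) (Fin n) ℂ) :
    frobSq (mcomm (diagonal fun i => (a i : ℂ)) X) =
      ∑ i, ∑ j, (a i - a j) ^ 2 * Complex.normSq (X i j) := by
  rw [frobSq_eq_sum]
  refine Finset.sum_congr rfl fun i _ => Finset.sum_congr rfl fun j _ => ?_
  have : mcomm (diagonal fun i => (a i : ℂ)) X i j = ((a i - a j : ℝ) : ℂ) * X i j := by
    simp [mcomm]; ring
  rw [this, Complex.normSq_mul, Complex.normSq_ofReal, sq]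

/-- Bessel's inequality, for one off-diagonal entry of an orthogonal family of Hermitian
matrices. -/
lemma sum_re_sq_div_frobSq_le {n : ℕ} {ι : Type*} [Fintype ι]
    {X : ι → Matrix (Fin n) (Fin n) ℂ} (hX : ∀ s, (X s)ᴴ = X s)
    (horth : ∀ s t, s ≠ t → frobInner (X s) (X t) = 0) {i j : Fin n} (hij : i ≠ j)
    {z : ℂ} (hz : Complex.normSq z = 1) :
    ∑ s, (z * X s i j).re ^ 2 / frobSq (X s) ≤ 1 / 2 := by
  classical
  set c : ι → ℝ := fun s => (z * X s i j).re / frobSq (X s) with hc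
  set Z := ∑ s, (c s : ℂ) • X s with hZ
  set S := ∑ s, (z * X s i j).re ^ 2 / frobSq (X s) with hS
  have hZh : Zᴴ = Z := by
    simp [hZ, Matrix.conjTranspose_sum, hX]
  have hre : (z * Z i j).re = S := by
    have : z * Z i j = ∑ s, (c s : ℂ) * (z * X s i j) := by
      simp only [hZ, Matrix.sum_apply, Matrix.smul_apply, smul_eq_mul, Finset.mul_sum]
      exact Finset.sum_congr rfl fun s _ => by ring
    rw [this, Complex.re_sum]
    refine Finset.sum_congr rfl fun s _ => ?_
    rw [Complex.re_ofReal_mul, hc]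
    ring
  have hsq : frobSq Z = S := by
    change frobInner Z Z = S
    rw [hZ, frobInner_sum_smul_left]
    refine Finset.sum_congr rfl fun s _ => ?_
    rw [frobInner_sum_smul_right, Finset.sum_eq_single s]
    · change c s * (c s * frobSq (X s)) = _
      by_cases h0 : frobSq (X s) = 0
      · simp [hc, h0]
      · simp only [hc]; field_simp
    · intro t _ hts
      rw [horth s t hts.symm, mul_zero]
    · simp
  have h1 := two_mul_normSq_apply_le_frobSq hZh hij
  have h2 : (z * Z i j).re ^ 2 ≤ Complex.normSq (Z i j) := by
    have : Complex.normSq (z * Z i j) = Complex.normSq (Z i j) := by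
      rw [Complex.normSq_mul, hz, one_mul]
    rw [← this, Complex.normSq_apply]
    nlinarith [mul_self_nonneg (z * Z i j).im]
  rw [hre] at h2
  rw [hsq] at h1
  nlinarith

lemma sum_normSq_div_frobSq_le {n : ℕ} {ι : Type*} [Fintype ι]
    {X : ι → Matrix (Fin n) (Fin n) ℂ} (hX : ∀ s, (X s)ᴴ = X s)
    (horth : ∀ s t, s ≠ t → frobInner (X s) (X t) = 0) {i j : Fin n} (hij : i ≠ j) :
    ∑ s, Complex.normSq (X s i j) / frobSq (X s) ≤ 1 := by
  have h1 := sum_re_sq_div_frobSq_le hX horth hij (z := 1) (by simp)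
  have h2 := sum_re_sq_div_frobSq_le hX horth hij (z := Complex.I) (by simp)
  have : ∑ s, Complex.normSq (X s i j) / frobSq (X s) =
      ∑ s, ((1 : ℂ) * X s i j).re ^ 2 / frobSq (X s) +
        ∑ s, (Complex.I * X s i j).re ^ 2 / frobSq (X s) := by
    rw [← Finset.sum_add_distrib]
    refine Finset.sum_congr rfl fun s _ => ?_
    rw [Complex.normSq_apply]
    simp
    ring
  linarith

/-- Edge form of the bound `λ_max ≤ |E| + 1` for the Laplacian of a graph. -/
lemma sum_sub_sq_le {n : ℕ} (a : Fin n → ℝ) (E : Finset (Fin n × Fin n))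
    (hE : ∀ e ∈ E, 0 ≤ a e.1 - a e.2) :
    ∑ e ∈ E, (a e.1 - a e.2) ^ 2 ≤ (∑ i, a i ^ 2) * (E.card + 1) := by
  set t : Fin n × Fin n → ℝ := fun e => a e.1 - a e.2 with ht
  set d : Fin n × Fin n → Fin n → ℝ :=
    fun e k => (if e.1 = k then 1 else 0) - (if e.2 = k then 1 else 0) with hd
  set w : Fin n → ℝ := fun k => ∑ e ∈ E, t e * d e k with hw
  set Q := ∑ e ∈ E, t e ^ 2 with hQ
  have hda : ∀ e, ∑ k, a k * d e k = t e := by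
    intro e
    simp [hd, ht, mul_sub, Finset.sum_sub_distrib]
  have h1 : ∑ k, a k * w k = Q := by
    simp only [hw, Finset.mul_sum]
    rw [Finset.sum_comm]
    refine Finset.sum_congr rfl fun e _ => ?_
    rw [sq]
    nth_rw 2 [← hda e]
    rw [Finset.sum_mul]
    exact Finset.sum_congr rfl fun k _ => by ring
  have hgram : ∀ e f, ∑ k, d e k * d f k ≤ 1 + if e = f then 1 else 0 := by
    intro e f
    have : ∑ k, d e k * d f k = d f e.1 - d f e.2 := by
      simp [hd, sub_mul, Finset.sum_sub_distrib]
    rw [this]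
    rcases e with ⟨e1, e2⟩
    rcases f with ⟨f1, f2⟩
    simp only [hd, Prod.mk.injEq]
    split_ifs <;> first | (norm_num; done) | (exfalso; tauto)
  have h2 : ∑ k, w k ^ 2 ≤ (∑ e ∈ E, t e) ^ 2 + Q := by
    have : ∑ k, w k ^ 2 = ∑ e ∈ E, ∑ f ∈ E, t e * t f * ∑ k, d e k * d f k := by
      simp_rw [hw, sq, Finset.sum_mul_sum, Finset.mul_sum]
      rw [Finset.sum_comm]
      refine Finset.sum_congr rfl fun e _ => ?_
      rw [Finset.sum_comm]
      exact Finset.sum_congr rfl fun f _ => Finset.sum_congr rfl fun k _ => by ring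
    rw [this]
    calc _ ≤ ∑ e ∈ E, ∑ f ∈ E, t e * t f * (1 + if e = f then 1 else 0) := by
          refine Finset.sum_le_sum fun e he => Finset.sum_le_sum fun f hf => ?_
          exact mul_le_mul_of_nonneg_left (hgram e f) (mul_nonneg (hE e he) (hE f hf))
      _ = _ := by
          simp only [mul_add, mul_one, Finset.sum_add_distrib, mul_ite, mul_zero]
          rw [sq, Finset.sum_mul_sum, hQ]
          congr 1
          refine Finset.sum_congr rfl fun e he => ?_
          rw [Finset.sum_ite_eq, if_pos he, sq]
  have h3 : (∑ e ∈ E, t e) ^ 2 ≤ E.card * Q := sq_sum_le_card_mul_sum_sq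
  have h4 : Q ^ 2 ≤ (∑ k, a k ^ 2) * ∑ k, w k ^ 2 := by
    rw [← h1]
    exact Finset.sum_mul_sq_le_sq_mul_sq _ _ _
  have hQ0 : 0 ≤ Q := Finset.sum_nonneg fun e _ => sq_nonneg _
  have ha0 : 0 ≤ ∑ k, a k ^ 2 := Finset.sum_nonneg fun e _ => sq_nonneg _
  have h5 : Q ^ 2 ≤ (∑ k, a k ^ 2) * ((E.card + 1) * Q) :=
    h4.trans (mul_le_mul_of_nonneg_left (by linarith) ha0)
  rcases hQ0.eq_or_lt with h | h
  · rw [← h]; positivity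
  · nlinarith

lemma sum_pos_part_le {n : ℕ} (a : Fin n → ℝ) :
    ∑ i, ∑ j, max ((a i - a j) ^ 2 - ∑ k, a k ^ 2) 0 ≤ 2 * ∑ k, a k ^ 2 := by
  set α := ∑ k, a k ^ 2 with hα
  have hα0 : 0 ≤ α := Finset.sum_nonneg fun e _ => sq_nonneg _
  set f : Fin n × Fin n → ℝ :=
    fun e => if 0 ≤ a e.1 - a e.2 then max ((a e.1 - a e.2) ^ 2 - α) 0 else 0 with hf
  set E : Finset (Fin n × Fin n) :=
    Finset.univ.filter fun e => 0 ≤ a e.1 - a e.2 ∧ α ≤ (a e.1 - a e.2) ^ 2 with hE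
  have h1 : ∑ e, f e ≤ α := by
    have : ∑ e, f e = ∑ e ∈ E, ((a e.1 - a e.2) ^ 2 - α) := by
      rw [hE, Finset.sum_filter]
      refine Finset.sum_congr rfl fun e _ => ?_
      simp only [hf]
      by_cases h : 0 ≤ a e.1 - a e.2
      · by_cases h' : α ≤ (a e.1 - a e.2) ^ 2
        · rw [if_pos h, if_pos ⟨h, h'⟩, max_eq_left (by linarith)]
        · rw [if_pos h, if_neg (by tauto), max_eq_right (by linarith)]
      · rw [if_neg h, if_neg (by tauto)]
    rw [this, Finset.sum_sub_distrib, Finset.sum_const, nsmul_eq_mul]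
    have := sum_sub_sq_le a E fun e he => (Finset.mem_filter.1 he).2.1
    linarith
  have h2 : ∀ i j, max ((a i - a j) ^ 2 - α) 0 ≤ f (i, j) + f (j, i) := by
    intro i j
    have hs : (a j - a i) ^ 2 = (a i - a j) ^ 2 := by ring
    have h0 : 0 ≤ max ((a i - a j) ^ 2 - α) 0 := le_max_right _ _
    simp only [hf, hs]
    split_ifs <;> linarith
  have h3 : ∑ i, ∑ j, f (i, j) = ∑ e, f e := (Fintype.sum_prod_type f).symm
  calc _ ≤ ∑ i, ∑ j, (f (i, j) + f (j, i)) :=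
        Finset.sum_le_sum fun i _ => Finset.sum_le_sum fun j _ => h2 i j
    _ = ∑ i, ∑ j, f (i, j) + ∑ i, ∑ j, f (j, i) := by simp only [Finset.sum_add_distrib]
    _ = 2 * ∑ e, f e := by
        rw [Finset.sum_comm (f := fun i j => f (j, i)), h3]; ring
    _ ≤ _ := by linarith

lemma sq_add_sq_le_sum_sq {n : ℕ} (a : Fin n → ℝ) {i j : Fin n} (hij : i ≠ j) :
    a i ^ 2 + a j ^ 2 ≤ ∑ k, a k ^ 2 := by
  rw [← Finset.sum_pair (f := fun k => a k ^ 2) hij]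
  exact Finset.sum_le_sum_of_subset_of_nonneg (Finset.subset_univ _) fun k _ _ => sq_nonneg _

lemma sub_sq_le_two_mul_sum_sq {n : ℕ} (a : Fin n → ℝ) (i j : Fin n) :
    (a i - a j) ^ 2 ≤ 2 * ∑ k, a k ^ 2 := by
  by_cases hij : i = j
  · subst hij
    have : 0 ≤ ∑ k, a k ^ 2 := Finset.sum_nonneg fun k _ => sq_nonneg _
    simp only [sub_self]
    linarith
  · nlinarith [sq_add_sq_le_sum_sq a hij, sq_nonneg (a i + a j)]

lemma frobSq_mcomm_le {n : ℕ} {A : Matrix (Fin n) (Fin n) ℂ} (hA : Aᴴ = A)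
    (X : Matrix (Fin n) (Fin n) ℂ) : frobSq (mcomm A X) ≤ 2 * frobSq A * frobSq X := by
  obtain ⟨U, a, hU, hUA⟩ := exists_unitary_diagonal hA
  rw [← frobSq_conj hU (mcomm A X), ← mcomm_conj hU, hUA, ← frobSq_conj hU A, hUA,
    ← frobSq_conj hU X]
  erw [frobSq_mcomm_diagonal, frobSq_diagonal]
  rw [frobSq_eq_sum, Finset.mul_sum]
  refine Finset.sum_le_sum fun i _ => ?_
  rw [Finset.mul_sum]
  refine Finset.sum_le_sum fun j _ => ?_
  exact mul_le_mul_of_nonneg_right (sub_sq_le_two_mul_sum_sq a i j) (Complex.normSq_nonneg _)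

/-- A fractional knapsack bound: weights `q s ≤ 1/2` of total mass at most one pick out at most
half of each of the two largest values. -/
lemma sum_mul_le_half_add {ι : Type*} [DecidableEq ι] (S : Finset ι) {x q : ι → ℝ} {p : ι} {v : ℝ}
    (hq0 : ∀ s, 0 ≤ q s) (hq : q p ≤ 1 / 2) (hsum : ∑ s ∈ S, q s ≤ 1) (hv0 : 0 ≤ v)
    (hvp : v ≤ x p) (hv : ∀ s ∈ S, s ≠ p → x s ≤ v) :
    ∑ s ∈ S, x s * q s ≤ (x p + v) / 2 := by
  calc ∑ s ∈ S, x s * q s ≤ ∑ s ∈ S, (v * q s + if p = s then (x p - v) * q p else 0) := by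
        refine Finset.sum_le_sum fun s hs => ?_
        split_ifs with h
        · subst h; linarith
        · have := mul_le_mul_of_nonneg_right (hv s hs (Ne.symm h)) (hq0 s)
          linarith
    _ ≤ v * 1 + (x p - v) * (1 / 2) := by
        rw [Finset.sum_add_distrib, ← Finset.mul_sum, Finset.sum_ite_eq]
        have h1 := mul_le_mul_of_nonneg_left hsum hv0
        have h2 := mul_le_mul_of_nonneg_left hq (sub_nonneg.2 hvp)
        split_ifs
        · linarith
        · linarith
    _ = _ := by ring

lemma sum_frobSq_mcomm_diagonal_le {n m : ℕ} (a : Fin n → ℝ)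
    {X : Fin m → Matrix (Fin n) (Fin n) ℂ} (hX : ∀ s, (X s)ᴴ = X s)
    (horth : ∀ s t, s ≠ t → frobInner (X s) (X t) = 0) (S : Finset (Fin m)) {p : Fin m} {v : ℝ}
    (hv0 : 0 ≤ v) (hvp : v ≤ frobSq (X p)) (hv : ∀ s ∈ S, s ≠ p → frobSq (X s) ≤ v) :
    ∑ s ∈ S, frobSq (mcomm (diagonal fun i => (a i : ℂ)) (X s)) ≤
      (∑ i, a i ^ 2) * (∑ s ∈ S, frobSq (X s) + frobSq (X p) + v) := by
  set α := ∑ i, a i ^ 2 with hα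
  have hα0 : 0 ≤ α := Finset.sum_nonneg fun e _ => sq_nonneg _
  set w : Fin n → Fin n → ℝ := fun i j => max ((a i - a j) ^ 2 - α) 0 with hw
  have hq0 : ∀ i j s, 0 ≤ Complex.normSq (X s i j) / frobSq (X s) := fun i j s =>
    div_nonneg (Complex.normSq_nonneg _) (frobSq_nonneg _)
  have hmul : ∀ i j s, frobSq (X s) * (Complex.normSq (X s i j) / frobSq (X s)) =
      Complex.normSq (X s i j) := by
    intro i j s
    by_cases h : frobSq (X s) = 0
    · have : X s = 0 := frobSq_eq_zero h
      simp [this]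
    · field_simp
  have hentry : ∀ i j, i ≠ j →
      ∑ s ∈ S, Complex.normSq (X s i j) ≤ (frobSq (X p) + v) / 2 := by
    intro i j hij
    rw [← Finset.sum_congr rfl fun s _ => hmul i j s]
    refine sum_mul_le_half_add S (hq0 i j) ?_ ?_ hv0 hvp hv
    · have h2 := two_mul_normSq_apply_le_frobSq (hX p) hij
      exact div_le_of_le_mul₀ (frobSq_nonneg _) (by norm_num) (by linarith)
    · exact (Finset.sum_le_sum_of_subset_of_nonneg (Finset.subset_univ _)
        fun s _ _ => hq0 i j s).trans (sum_normSq_div_frobSq_le hX horth hij)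
  have hterm : ∀ i j, ∑ s ∈ S, ((a i - a j) ^ 2 - α) * Complex.normSq (X s i j) ≤
      w i j * ((frobSq (X p) + v) / 2) := by
    intro i j
    have hw0 : 0 ≤ w i j := le_max_right _ _
    by_cases hij : i = j
    · subst hij
      refine le_trans (Finset.sum_nonpos fun s _ => ?_)
        (mul_nonneg hw0 (by linarith))
      have := mul_nonneg hα0 (Complex.normSq_nonneg (X s i i))
      simp only [sub_self]
      linarith
    · calc _ ≤ ∑ s ∈ S, w i j * Complex.normSq (X s i j) :=
            Finset.sum_le_sum fun s _ =>
              mul_le_mul_of_nonneg_right (le_max_left _ _) (Complex.normSq_nonneg _)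
        _ = w i j * ∑ s ∈ S, Complex.normSq (X s i j) := by rw [Finset.mul_sum]
        _ ≤ _ := mul_le_mul_of_nonneg_left (hentry i j hij) hw0
  have hsplit : ∑ s ∈ S, frobSq (mcomm (diagonal fun i => (a i : ℂ)) (X s)) =
      α * ∑ s ∈ S, frobSq (X s) +
        ∑ i, ∑ j, ∑ s ∈ S, ((a i - a j) ^ 2 - α) * Complex.normSq (X s i j) := by
    have : ∀ s, frobSq (mcomm (diagonal fun i => (a i : ℂ)) (X s)) = α * frobSq (X s) +
        ∑ i, ∑ j, ((a i - a j) ^ 2 - α) * Complex.normSq (X s i j) := by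
      intro s
      rw [frobSq_mcomm_diagonal, frobSq_eq_sum (X s)]
      simp only [Finset.mul_sum, ← Finset.sum_add_distrib]
      exact Finset.sum_congr rfl fun i _ => Finset.sum_congr rfl fun j _ => by ring
    simp_rw [this]
    rw [Finset.sum_add_distrib, Finset.mul_sum, Finset.sum_comm]
    congr 1
    exact Finset.sum_congr rfl fun i _ => Finset.sum_comm
  have hbound : ∑ i, ∑ j, ∑ s ∈ S, ((a i - a j) ^ 2 - α) * Complex.normSq (X s i j) ≤
      2 * α * ((frobSq (X p) + v) / 2) := by
    calc _ ≤ ∑ i, ∑ j, w i j * ((frobSq (X p) + v) / 2) :=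
          Finset.sum_le_sum fun i _ => Finset.sum_le_sum fun j _ => hterm i j
      _ = (∑ i, ∑ j, w i j) * ((frobSq (X p) + v) / 2) := by simp only [Finset.sum_mul]
      _ ≤ _ := mul_le_mul_of_nonneg_right (sum_pos_part_le a) (by linarith)
  rw [hsplit]
  linarith

/-- The commutators of one Hermitian matrix with an orthogonal family of Hermitian matrices;
`frobSq (X p)` and `v` bound the two largest squared norms in the family. -/
lemma sum_frobSq_mcomm_le {n m : ℕ} {A : Matrix (Fin n) (Fin n) ℂ} (hA : Aᴴ = A)
    {X : Fin m → Matrix (Fin n) (Fin n) ℂ} (hX : ∀ s, (X s)ᴴ = X s)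
    (horth : ∀ s t, s ≠ t → frobInner (X s) (X t) = 0) (S : Finset (Fin m)) {p : Fin m} {v : ℝ}
    (hv0 : 0 ≤ v) (hvp : v ≤ frobSq (X p)) (hv : ∀ s ∈ S, s ≠ p → frobSq (X s) ≤ v) :
    ∑ s ∈ S, frobSq (mcomm A (X s)) ≤
      frobSq A * (∑ s ∈ S, frobSq (X s) + frobSq (X p) + v) := by
  obtain ⟨U, a, hU, hUA⟩ := exists_unitary_diagonal hA
  have hUA' : Uᴴ * A * U = diagonal fun i => (a i : ℂ) := hUA
  have key := sum_frobSq_mcomm_diagonal_le a (X := fun s => Uᴴ * X s * U)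
    (fun s => by simp [hX, Matrix.mul_assoc])
    (fun s t hst => by rw [frobInner_conj hU]; exact horth s t hst) S (p := p) hv0
    (by rwa [frobSq_conj hU]) (fun s hs hsp => by rw [frobSq_conj hU]; exact hv s hs hsp)
  simp only [← hUA', mcomm_conj hU, frobSq_conj hU] at key
  rwa [← frobSq_diagonal, ← hUA', frobSq_conj hU] at key

lemma exists_three_largest {m : ℕ} (hm : 3 ≤ m) (x : Fin m → ℝ) :
    ∃ p q r : Fin m, p ≠ q ∧ p ≠ r ∧ q ≠ r ∧ x q ≤ x p ∧ x r ≤ x q ∧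
      ∀ s, s ≠ p → s ≠ q → x s ≤ x r := by
  have hne : ∀ T : Finset (Fin m), T.card < m → (Finset.univ \ T).Nonempty := by
    intro T hT
    rw [← Finset.card_pos, Finset.card_sdiff_of_subset (Finset.subset_univ _)]
    simpa using hT
  obtain ⟨p, -, hp⟩ := Finset.exists_max_image (Finset.univ \ ∅) x (hne ∅ (by simp; omega))
  obtain ⟨q, hq', hq⟩ := Finset.exists_max_image (Finset.univ \ {p}) x (hne {p} (by simp; omega))
  obtain ⟨r, hr', hr⟩ := Finset.exists_max_image (Finset.univ \ {p, q}) x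
    (hne {p, q} (by have := Finset.card_le_two (a := p) (b := q); omega))
  simp only [Finset.mem_sdiff, Finset.mem_univ, true_and, Finset.mem_insert,
    Finset.mem_singleton, not_or] at hp hq hr hq' hr'
  exact ⟨p, q, r, Ne.symm hq', Ne.symm hr'.1, Ne.symm hr'.2, hp q (by simp), hq r hr'.1,
    fun s hs hs' => hr s ⟨hs, hs'⟩⟩

lemma sum_eq_add_sum_sdiff_three {m : ℕ} {p q r : Fin m} (hpq : p ≠ q) (hpr : p ≠ r) (hqr : q ≠ r)
    (g : Fin m → ℝ) : ∑ s, g s = g p + g q + g r + ∑ s ∈ Finset.univ \ {p, q, r}, g s := by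
  rw [← Finset.sum_sdiff (Finset.subset_univ {p, q, r}), Finset.sum_insert (by simp [hpq, hpr]),
    Finset.sum_pair hqr]
  ring

lemma sum_eq_three {m : ℕ} {p q r : Fin m} (hpq : p ≠ q) (hpr : p ≠ r) (hqr : q ≠ r)
    {g : Fin m → ℝ} (hg : ∀ s, s ≠ p → s ≠ q → s ≠ r → g s = 0) :
    ∑ s, g s = g p + g q + g r := by
  rw [sum_eq_add_sum_sdiff_three hpq hpr hqr, Finset.sum_eq_zero, add_zero]
  intro t ht
  simp only [Finset.mem_sdiff, Finset.mem_insert, Finset.mem_singleton, not_or] at ht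
  exact hg t ht.2.1 ht.2.2.1 ht.2.2.2

/-- The equality case of the commutator inequality for an orthogonal family: exactly three
members can be nonzero, with equal norms and extremal commutators. -/
lemma exists_triple_of_equality {n m : ℕ} (hm : 3 ≤ m) {X : Fin m → Matrix (Fin n) (Fin n) ℂ}
    (hX : ∀ s, (X s)ᴴ = X s) (horth : ∀ s t, s ≠ t → frobInner (X s) (X t) = 0)
    (heq : ∑ r, ∑ s, frobSq (mcomm (X r) (X s)) = (4 / 3) * (∑ r, frobSq (X r)) ^ 2) :
    ∃ (p q r : Fin m) (x : ℝ), p ≠ q ∧ p ≠ r ∧ q ≠ r ∧ frobSq (X p) = x ∧ frobSq (X q) = x ∧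
      frobSq (X r) = x ∧ (∀ s, s ≠ p → s ≠ q → s ≠ r → X s = 0) ∧
      frobSq (mcomm (X p) (X q)) = 2 * x ^ 2 ∧ frobSq (mcomm (X p) (X r)) = 2 * x ^ 2 := by
  obtain ⟨p, q, r, hpq, hpr, hqr, hqp', hrq', hle⟩ :=
    exists_three_largest hm fun s => frobSq (X s)
  set x : Fin m → ℝ := fun s => frobSq (X s) with hx
  set T := ∑ s, x s with hT
  have hx0 : ∀ s, 0 ≤ x s := fun s => frobSq_nonneg _
  set F : Fin m → Fin m → ℝ := fun s t => frobSq (mcomm (X s) (X t)) with hF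
  have hFself : ∀ s, F s s = 0 := fun s => by simp [hF, mcomm_self]
  have hrow : ∀ (s u : Fin m) (v : ℝ), 0 ≤ v → v ≤ x u → (∀ t, t ≠ s → t ≠ u → x t ≤ v) →
      ∑ t, F s t ≤ x s * (T - x s + x u + v) := by
    intro s u v hv0 hvu hv
    have h := sum_frobSq_mcomm_le (hX s) hX horth (Finset.univ.erase s) (p := u) hv0 hvu
      (fun t ht htu => hv t (Finset.ne_of_mem_erase ht) htu)
    have e1 := Finset.add_sum_erase Finset.univ (F s) (Finset.mem_univ s)
    have e2 := Finset.add_sum_erase Finset.univ x (Finset.mem_univ s)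
    rw [hFself, zero_add] at e1
    rw [← e1]
    have e3 : ∑ t ∈ Finset.univ.erase s, x t = T - x s := by linarith
    rw [← e3]
    exact h
  have hrest := sum_eq_add_sum_sdiff_three hpq hpr hqr
  set u := ∑ s ∈ Finset.univ \ {p, q, r}, x s with hu
  have hTu : T = x p + x q + x r + u := hrest x
  have hu0 : 0 ≤ u := Finset.sum_nonneg fun s _ => hx0 s
  have hp := hrow p q (x r) (hx0 r) hrq' fun t h1 h2 => hle t h1 h2
  have hq := hrow q p (x r) (hx0 r) (hrq'.trans hqp') fun t h1 h2 => hle t h2 h1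
  have hr := hrow r p (x q) (hx0 q) hqp' fun t h1 h2 => by
    by_cases h : t = q
    · rw [h]
    · exact (hle t h2 h).trans hrq'
  have hother : ∑ s ∈ Finset.univ \ {p, q, r}, ∑ t, F s t ≤ u * (T + x p + x q) := by
    rw [hu, Finset.sum_mul]
    refine Finset.sum_le_sum fun s _ => ?_
    have h := hrow s p (x q) (hx0 q) hqp' fun t h1 h2 => by
      by_cases h : t = q
      · rw [h]
      · exact (hle t h2 h).trans hrq'
    nlinarith [hx0 s]
  have heq' : ∑ s, ∑ t, F s t = 4 / 3 * T ^ 2 := heq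
  have htot := hrest fun s => ∑ t, F s t
  have hineq : 4 / 3 * T ^ 2 ≤ x p * (T - x p + x q + x r) + x q * (T - x q + x p + x r) +
      x r * (T - x r + x p + x q) + u * (T + x p + x q) := by linarith
  set d := x p + x q - 2 * x r with hd
  have hsos : (x p - x q) ^ 2 + (d ^ 2 + u ^ 2 - u * d) / 3 ≤ 0 := by
    rw [hTu] at hineq
    rw [hd]
    nlinarith
  have hpq0 : x p - x q = 0 := by
    refine pow_eq_zero_iff two_ne_zero |>.1 (le_antisymm ?_ (sq_nonneg _))
    nlinarith [sq_nonneg (2 * d - u), sq_nonneg u]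
  have hu' : u = 0 := by
    refine pow_eq_zero_iff two_ne_zero |>.1 (le_antisymm ?_ (sq_nonneg _))
    nlinarith [sq_nonneg (2 * d - u), sq_nonneg (x p - x q)]
  have hd0 : d = 0 := by
    refine pow_eq_zero_iff two_ne_zero |>.1 (le_antisymm ?_ (sq_nonneg _))
    rw [hu'] at hsos
    nlinarith [sq_nonneg (x p - x q)]
  have hqx : x q = x p := by linarith
  have hrx : x r = x p := by linarith
  have hzero : ∀ s, s ≠ p → s ≠ q → s ≠ r → X s = 0 := by
    intro s h1 h2 h3
    have := (Finset.sum_eq_zero_iff_of_nonneg fun s _ => hx0 s).1 hu' s (by simp [h1, h2, h3])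
    exact frobSq_eq_zero this
  have hbd : ∀ s t, F s t ≤ 2 * x s * x t := fun s t => frobSq_mcomm_le (hX s) (X t)
  have hsym : ∀ s t, F s t = F t s := fun s t => frobSq_mcomm_comm _ _
  have hFz : ∀ s, s ≠ p → s ≠ q → s ≠ r → ∀ t, F s t = 0 := by
    intro s h1 h2 h3 t
    simp [hF, hzero s h1 h2 h3, mcomm]
  have hrowsum : ∀ s, ∑ t, F s t = F s p + F s q + F s r := fun s =>
    sum_eq_three hpq hpr hqr fun t h1 h2 h3 => by rw [hsym, hFz t h1 h2 h3]
  have hsum : F p q + F p r + F q r = 6 * x p ^ 2 := by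
    have h := sum_eq_three hpq hpr hqr (g := fun s => ∑ t, F s t) fun s h1 h2 h3 =>
      Finset.sum_eq_zero fun t _ => hFz s h1 h2 h3 t
    rw [heq', hrowsum, hrowsum, hrowsum, hFself, hFself, hFself, hsym q p, hsym r p, hsym r q,
      hTu, hqx, hrx, hu'] at h
    linarith
  have b1 := hbd p q
  have b2 := hbd p r
  have b3 := hbd q r
  rw [hqx] at b1 b3
  rw [hrx] at b2 b3
  have hmul : 2 * x p * x p = 2 * x p ^ 2 := by ring
  rw [hmul] at b1 b2 b3
  refine ⟨p, q, r, x p, hpq, hpr, hqr, rfl, hqx, hrx, hzero, ?_, ?_⟩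
  · change F p q = _
    linarith
  · change F p r = _
    linarith

/-- The Hermitian matrix with entry `y` at `(i, j)`, its conjugate at `(j, i)`, zero elsewhere. -/
noncomputable def hermPair {n : ℕ} (i j : Fin n) (y : ℂ) : Matrix (Fin n) (Fin n) ℂ :=
  fun k l => if k = i ∧ l = j then y else if k = j ∧ l = i then star y else 0

lemma frobInner_hermPair {n : ℕ} {i j : Fin n} (hij : i ≠ j) (y z : ℂ) :
    frobInner (hermPair i j y) (hermPair i j z) = 2 * (y * star z).re := by
  have h : frobInner (hermPair i j y) (hermPair i j z) =
      ∑ k, ∑ l, (hermPair i j y k l * star (hermPair i j z k l)).re := by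
    simp [frobInner, Matrix.trace, Matrix.mul_apply]
  rw [h]
  have hrow : ∀ k l, (hermPair i j y k l * star (hermPair i j z k l)).re =
      (if k = i then if l = j then (y * star z).re else 0 else 0) +
        if k = j then if l = i then (y * star z).re else 0 else 0 := by
    intro k l
    by_cases hki : k = i
    · subst hki
      by_cases hlj : l = j
      · simp [hermPair, hlj, hij]
      · simp [hermPair, hlj, hij]
    · by_cases hkj : k = j
      · by_cases hli : l = i
        · subst hkj hli
          simp [hermPair, hki]
        · subst hkj
          simp [hermPair, hki, hli]
      · simp [hermPair, hki, hkj]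
  simp_rw [hrow, Finset.sum_add_distrib]
  simp
  ring

lemma frobSq_hermPair {n : ℕ} {i j : Fin n} (hij : i ≠ j) (y : ℂ) :
    frobSq (hermPair i j y) = 2 * Complex.normSq y := by
  change frobInner _ _ = _
  rw [frobInner_hermPair hij]
  simp [Complex.mul_conj]

lemma eq_diagEmbed {n : ℕ} (hn : 2 ≤ n) {A : Matrix (Fin n) (Fin n) ℂ}
    {M : Matrix (Fin 2) (Fin 2) ℂ}
    (h00 : A ⟨0, by omega⟩ ⟨0, by omega⟩ = M 0 0) (h01 : A ⟨0, by omega⟩ ⟨1, by omega⟩ = M 0 1)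
    (h10 : A ⟨1, by omega⟩ ⟨0, by omega⟩ = M 1 0) (h11 : A ⟨1, by omega⟩ ⟨1, by omega⟩ = M 1 1)
    (hrow : ∀ k l : Fin n, 2 ≤ k.val → A k l = 0) (hcol : ∀ k l : Fin n, 2 ≤ l.val → A k l = 0) :
    A = diagEmbed M := by
  ext k l
  by_cases hk : k.val < 2
  · by_cases hl : l.val < 2
    · rw [diagEmbed, dif_pos ⟨hk, hl⟩]
      obtain ⟨k, hk'⟩ := k
      obtain ⟨l, hl'⟩ := l
      simp only at hk hl
      interval_cases k <;> interval_cases l <;> assumption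
    · rw [diagEmbed, dif_neg (by tauto), hcol k l (by omega)]
  · rw [diagEmbed, dif_neg (by tauto), hrow k l (by omega)]

lemma exists_perm_apply_eq {n : ℕ} {p q i j : Fin n} (hpq : p ≠ q) (hij : i ≠ j) :
    ∃ σ : Equiv.Perm (Fin n), σ p = i ∧ σ q = j := by
  refine ⟨Equiv.swap (Equiv.swap p i q) j * Equiv.swap p i, ?_, by simp⟩
  rw [Equiv.Perm.mul_apply, Equiv.swap_apply_left]
  refine Equiv.swap_apply_of_ne_of_ne (fun h => hpq ?_) hij
  exact (Equiv.swap p i).injective (by rw [← h, Equiv.swap_apply_left])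

/-- Normal form: permuting and rephasing the columns of `U` brings the triple to
the standard one. -/
lemma exists_unitary_standard_triple {n : ℕ} (hn : 2 ≤ n) {A B C U : Matrix (Fin n) (Fin n) ℂ}
    (hU : Uᴴ * U = 1) {a : Fin n → ℝ} {i j : Fin n} (hij : i ≠ j) {l : ℝ} (hl : 0 < l) {y : ℂ}
    (hy : Complex.normSq y = l ^ 2) (hai : a i = l) (haj : a j = -l)
    (ha : ∀ k, k ≠ i → k ≠ j → a k = 0) (hA : Uᴴ * A * U = diagonal fun i => (a i : ℂ))
    (hB : Uᴴ * B * U = hermPair i j y) (hC : Uᴴ * C * U = hermPair i j (-Complex.I * y)) :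
    ∃ P : Matrix (Fin n) (Fin n) ℂ, Pᴴ * P = 1 ∧ Pᴴ * A * P = diagEmbed (H1 l) ∧
      Pᴴ * B * P = diagEmbed (H2 l) ∧ Pᴴ * C * P = diagEmbed (H3 l) := by
  obtain ⟨σ, hσ0, hσ1⟩ := exists_perm_apply_eq (p := (⟨0, by omega⟩ : Fin n))
    (q := ⟨1, by omega⟩) (by simp) hij
  have hσi : ∀ k : Fin n, 2 ≤ k.val → σ k ≠ i := by
    intro k hk h
    rw [← hσ0] at h
    have := congrArg Fin.val (σ.injective h)
    simp at this
    omega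
  have hσj : ∀ k : Fin n, 2 ≤ k.val → σ k ≠ j := by
    intro k hk h
    rw [← hσ1] at h
    have := congrArg Fin.val (σ.injective h)
    simp at this
    omega
  have hlc : (l : ℂ) ≠ 0 := by exact_mod_cast hl.ne'
  have hyy : y * star y = (l : ℂ) ^ 2 := by
    have := Complex.mul_conj y
    rw [hy] at this
    simpa using this
  have hyy' : star y * y = (l : ℂ) ^ 2 := by rw [mul_comm, hyy]
  set d : Fin n → ℂ := fun k => if k.val = 0 then y / l else 1 with hd
  have hdd : ∀ k, star (d k) * d k = 1 := by
    intro k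
    simp only [hd]
    split_ifs
    · rw [star_div₀]
      simp only [Complex.star_def, Complex.conj_ofReal] at hyy' ⊢
      field_simp
      exact hyy'
    · simp
  set V := U.submatrix id σ with hV
  set P := V * diagonal d with hP
  have hentry : ∀ M : Matrix (Fin n) (Fin n) ℂ, ∀ k l,
      (Pᴴ * M * P) k l = star (d k) * (Uᴴ * M * U) (σ k) (σ l) * d l := by
    intro M k l
    have h1 : Pᴴ * M * P = diagonal (star d) * (Vᴴ * M * V) * diagonal d := by
      rw [hP, Matrix.conjTranspose_mul, Matrix.diagonal_conjTranspose]
      simp only [Matrix.mul_assoc]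
    have h2 : (Vᴴ * M * V) k l = (Uᴴ * M * U) (σ k) (σ l) := rfl
    rw [h1, Matrix.mul_diagonal, Matrix.diagonal_mul, h2]
    rfl
  have hH : ∀ w : ℂ, star (y / l) * hermPair i j w i j * 1 = star (y / l) * w ∧
      1 * hermPair i j w j i * (y / l) = star w * (y / l) := by
    intro w
    simp [hermPair, hij.symm]
  have hz : ∀ w k l, (2 ≤ k.val ∨ 2 ≤ l.val) → hermPair i j w (σ k) (σ l) = 0 := by
    rintro w k l (h | h)
    · simp [hermPair, hσi k h, hσj k h]
    · simp [hermPair, hσi l h, hσj l h]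
  refine ⟨P, ?_, ?_, ?_, ?_⟩
  · ext k l
    have h := hentry 1 k l
    rw [Matrix.mul_one, Matrix.mul_one, hU] at h
    rw [h, Matrix.one_apply, Matrix.one_apply]
    by_cases hkl : k = l
    · subst hkl
      simpa using hdd k
    · simp [hkl]
  · refine eq_diagEmbed hn ?_ ?_ ?_ ?_ ?_ ?_ <;> simp only [hentry, hA, hσ0, hσ1]
    · rw [Matrix.diagonal_apply_eq, mul_right_comm, hdd, hai]
      simp [H1]
    · simp [hij, H1]
    · simp [hij.symm, H1]
    · rw [Matrix.diagonal_apply_eq, mul_right_comm, hdd, haj]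
      simp [H1]
    · intro k l hk
      by_cases hkl : k = l
      · subst hkl; simp [ha _ (hσi k hk) (hσj k hk)]
      · simp [hkl]
    · intro k l hk
      by_cases hkl : k = l
      · subst hkl; simp [ha _ (hσi k hk) (hσj k hk)]
      · simp [hkl]
  · refine eq_diagEmbed hn ?_ ?_ ?_ ?_ ?_ ?_ <;> simp only [hentry, hB, hσ0, hσ1]
    · simp [hermPair, hij, H2]
    · simp only [hd, one_ne_zero, if_true, if_false, (hH y).1, H2]
      simp only [star_div₀, Complex.star_def, Complex.conj_ofReal] at hyy' ⊢
      simp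
      field_simp
      exact hyy'
    · simp only [hd, one_ne_zero, if_true, if_false, star_one, (hH y).2, H2]
      simp
      field_simp
      simpa using hyy'
    · simp [hermPair, hij.symm, H2]
    · intro k l hk; simp [hz y k l (Or.inl hk)]
    · intro k l hk; simp [hz y k l (Or.inr hk)]
  · refine eq_diagEmbed hn ?_ ?_ ?_ ?_ ?_ ?_ <;> simp only [hentry, hC, hσ0, hσ1]
    · simp [hermPair, hij, H3]
    · simp only [hd, one_ne_zero, if_true, if_false, (hH _).1, H3]
      simp only [star_div₀, Complex.star_def, Complex.conj_ofReal] at hyy' ⊢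
      simp
      field_simp
      linear_combination hyy'
    · simp only [hd, one_ne_zero, if_true, if_false, star_one, (hH _).2, H3]
      simp only [Complex.star_def] at hyy' ⊢
      simp
      field_simp
      linear_combination hyy'
    · simp [hermPair, hij.symm, H3]
    · intro k l hk; simp [hz _ k l (Or.inl hk)]
    · intro k l hk; simp [hz _ k l (Or.inr hk)]

/-- Extremality of the commutator with a diagonal matrix forces entries off the extreme spectral
gap to vanish. -/
lemma sub_sq_eq_of_extremal {n : ℕ} {a : Fin n → ℝ} {Y : Matrix (Fin n) (Fin n) ℂ}
    (h : frobSq (mcomm (diagonal fun i => (a i : ℂ)) Y) = 2 * (∑ k, a k ^ 2) * frobSq Y)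
    {i j : Fin n} (hY : Y i j ≠ 0) : (a i - a j) ^ 2 = 2 * ∑ k, a k ^ 2 := by
  have h0 : ∑ i, ∑ j, (2 * (∑ k, a k ^ 2) - (a i - a j) ^ 2) * Complex.normSq (Y i j) = 0 := by
    simp only [sub_mul, Finset.sum_sub_distrib, ← Finset.mul_sum]
    rw [← frobSq_eq_sum, ← h, frobSq_mcomm_diagonal, sub_self]
  have hnn : ∀ i j, 0 ≤ (2 * (∑ k, a k ^ 2) - (a i - a j) ^ 2) * Complex.normSq (Y i j) :=
    fun i j => mul_nonneg (sub_nonneg.2 (sub_sq_le_two_mul_sum_sq a i j)) (Complex.normSq_nonneg _)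
  have h1 := (Finset.sum_eq_zero_iff_of_nonneg fun i _ => Finset.sum_nonneg fun j _ => hnn i j).1
    h0 i (Finset.mem_univ i)
  have h2 := (Finset.sum_eq_zero_iff_of_nonneg fun j _ => hnn i j).1 h1 j (Finset.mem_univ j)
  rcases mul_eq_zero.1 h2 with h3 | h3
  · linarith
  · exact absurd (Complex.normSq_eq_zero.1 h3) hY

lemma exists_standard_triple {n : ℕ} (hn : 2 ≤ n) {A B C : Matrix (Fin n) (Fin n) ℂ}
    (hA : Aᴴ = A) (hB : Bᴴ = B) (hC : Cᴴ = C) {x : ℝ} (hAx : frobSq A = x) (hBx : frobSq B = x)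
    (hCx : frobSq C = x) (hBC : frobInner B C = 0) (hAB : frobSq (mcomm A B) = 2 * x ^ 2)
    (hAC : frobSq (mcomm A C) = 2 * x ^ 2) :
    ∃ (P : Matrix (Fin n) (Fin n) ℂ) (l : ℝ), Pᴴ * P = 1 ∧ 0 ≤ l ∧
      Pᴴ * A * P = diagEmbed (H1 l) ∧
      ((Pᴴ * B * P = diagEmbed (H2 l) ∧ Pᴴ * C * P = diagEmbed (H3 l)) ∨
        (Pᴴ * C * P = diagEmbed (H2 l) ∧ Pᴴ * B * P = diagEmbed (H3 l))) := by
  have hx0 : 0 ≤ x := hAx ▸ frobSq_nonneg A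
  rcases hx0.eq_or_lt with rfl | hx
  · have hz : ∀ M ∈ [H1 0, H2 0, H3 0], (diagEmbed M : Matrix (Fin n) (Fin n) ℂ) = 0 := by
      intro M hM
      have hM0 : M = 0 := by
        simp only [List.mem_cons, List.not_mem_nil, or_false] at hM
        rcases hM with rfl | rfl | rfl <;> ext a b <;> fin_cases a <;> fin_cases b <;>
          simp [H1, H2, H3]
      subst hM0
      ext a b
      simp [diagEmbed]
    refine ⟨1, 0, by simp, le_rfl, ?_, Or.inl ⟨?_, ?_⟩⟩
    · rw [frobSq_eq_zero hAx, hz _ (by simp)]; simp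
    · rw [frobSq_eq_zero hBx, hz _ (by simp)]; simp
    · rw [frobSq_eq_zero hCx, hz _ (by simp)]; simp
  obtain ⟨U, a, hU, hUA⟩ := exists_unitary_diagonal hA
  replace hUA : Uᴴ * A * U = diagonal fun i => (a i : ℂ) := hUA
  have hα : ∑ k, a k ^ 2 = x := by rw [← frobSq_diagonal, ← hUA, frobSq_conj hU, hAx]
  have hext : ∀ Y, frobSq Y = x → frobSq (mcomm A Y) = 2 * x ^ 2 → ∀ i j,
      (Uᴴ * Y * U) i j ≠ 0 → (a i - a j) ^ 2 = 2 * x := by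
    intro Y hYx hY i j hne
    rw [← hα]
    refine sub_sq_eq_of_extremal ?_ hne
    rw [← hUA, mcomm_conj hU, frobSq_conj hU, frobSq_conj hU, hY, hα, hYx]
    ring
  have hherm : ∀ Y, Yᴴ = Y → (Uᴴ * Y * U)ᴴ = Uᴴ * Y * U := by
    intro Y hY
    simp [hY, Matrix.mul_assoc]
  obtain ⟨i, j, hgap, hai0⟩ : ∃ i j, (a i - a j) ^ 2 = 2 * x ∧ 0 ≤ a i - a j := by
    have hne : Uᴴ * B * U ≠ 0 := by
      intro h
      rw [← frobSq_conj hU, h, frobSq_zero] at hBx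
      exact hx.ne hBx
    obtain ⟨i, j, hij⟩ : ∃ i j, (Uᴴ * B * U) i j ≠ 0 := by
      by_contra! h
      exact hne (Matrix.ext h)
    have hg := hext B hBx hAB i j hij
    rcases le_total 0 (a i - a j) with h | h
    · exact ⟨i, j, hg, h⟩
    · exact ⟨j, i, by rw [← hg]; ring, by linarith⟩
  have hij : i ≠ j := by
    rintro rfl
    simp only [sub_self] at hgap
    linarith
  have hle := sq_add_sq_le_sum_sq a hij
  have haj : a j = -a i := by
    have : (a i + a j) ^ 2 = 0 := le_antisymm (by nlinarith) (sq_nonneg _)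
    linarith [pow_eq_zero_iff two_ne_zero |>.1 this]
  set l := a i with hl
  have hx2 : x = 2 * l ^ 2 := by rw [haj] at hgap; linarith
  have hlpos : 0 < l := by
    rw [haj] at hai0
    refine lt_of_le_of_ne (by linarith) fun h => ?_
    rw [← h] at hx2
    linarith
  have ha0 : ∀ k, k ≠ i → k ≠ j → a k = 0 := by
    intro k hki hkj
    have h := Finset.sum_le_sum_of_subset_of_nonneg (Finset.subset_univ {k, i, j})
      fun k _ _ => sq_nonneg (a k)
    rw [Finset.sum_insert (by simp [hki, hkj]), Finset.sum_pair hij, hα, haj] at h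
    refine pow_eq_zero_iff two_ne_zero |>.1 (le_antisymm ?_ (sq_nonneg (a k)))
    linarith
  have hpair : ∀ Y, Yᴴ = Y → frobSq Y = x → frobSq (mcomm A Y) = 2 * x ^ 2 →
      ∃ y, Uᴴ * Y * U = hermPair i j y ∧ Complex.normSq y = l ^ 2 := by
    intro Y hY hYx hAY
    have hform : Uᴴ * Y * U = hermPair i j ((Uᴴ * Y * U) i j) := by
      ext k k'
      by_cases h1 : k = i ∧ k' = j
      · rw [hermPair, if_pos h1, h1.1, h1.2]
      by_cases h2 : k = j ∧ k' = i
      · rw [hermPair, if_neg h1, if_pos h2, h2.1, h2.2]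
        conv_lhs => rw [← hherm Y hY]
        rfl
      rw [hermPair, if_neg h1, if_neg h2]
      by_contra hne
      have hg := hext Y hYx hAY k k' hne
      have hval : ∀ k, (k = i ∧ a k = l) ∨ (k = j ∧ a k = -l) ∨ a k = 0 := by
        intro k
        by_cases hki : k = i
        · exact Or.inl ⟨hki, by rw [hki]⟩
        · by_cases hkj : k = j
          · exact Or.inr (Or.inl ⟨hkj, by rw [hkj, haj]⟩)
          · exact Or.inr (Or.inr (ha0 k hki hkj))
      have hl2 : 0 < l ^ 2 := by positivity
      rcases hval k with ⟨hk, e⟩ | ⟨hk, e⟩ | e <;> rcases hval k' with ⟨hk', e'⟩ | ⟨hk', e'⟩ | e' <;>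
        first
        | exact h1 ⟨hk, hk'⟩
        | exact h2 ⟨hk, hk'⟩
        | (rw [e, e', hx2] at hg; nlinarith)
    refine ⟨_, hform, ?_⟩
    have := frobSq_hermPair hij ((Uᴴ * Y * U) i j)
    rw [← hform, frobSq_conj hU, hYx, hx2] at this
    linarith
  obtain ⟨y, hBy, hy⟩ := hpair B hB hBx hAB
  obtain ⟨z, hCz, hz⟩ := hpair C hC hCx hAC
  have hre : (y * star z).re = 0 := by
    have := frobInner_hermPair hij y z
    rw [← hBy, ← hCz, frobInner_conj hU, hBC] at this
    linarith
  have hsplit : z = -Complex.I * y ∨ y = -Complex.I * z := by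
    set t := (y * star z).im with ht
    have hw : y * star z = t * Complex.I := by
      apply Complex.ext
      · rw [hre]; simp
      · simp [ht]
    have hl2 : 0 < l ^ 2 := by positivity
    have ht2 : (t - l ^ 2) * (t + l ^ 2) = 0 := by
      have h := congrArg Complex.normSq hw
      simp only [Complex.normSq_mul, Complex.star_def, Complex.normSq_conj, hy, hz,
        Complex.normSq_ofReal, Complex.normSq_I] at h
      linarith
    have hzz : star z * z = (l : ℂ) ^ 2 := by
      have := Complex.normSq_eq_conj_mul_self (z := z)
      rw [hz] at this
      simpa using this.symm
    have hyz : (l : ℂ) ^ 2 * y = t * Complex.I * z := by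
      rw [← hw, mul_assoc, hzz, mul_comm]
    have hlc : (l : ℂ) ^ 2 ≠ 0 := by exact_mod_cast hl2.ne'
    rcases mul_eq_zero.1 ht2 with h | h
    · left
      rw [sub_eq_zero.1 h] at hyz
      push_cast at hyz
      rw [mul_assoc] at hyz
      rw [mul_left_cancel₀ hlc hyz]
      linear_combination z * Complex.I_mul_I
    · right
      rw [eq_neg_of_add_eq_zero_left h] at hyz
      push_cast at hyz
      refine mul_left_cancel₀ hlc ?_
      rw [hyz]
      ring
  rcases hsplit with h | h
  · rw [h] at hCz
    obtain ⟨P, hP, h1, h2, h3⟩ :=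
      exists_unitary_standard_triple hn hU hij hlpos hy rfl haj ha0 hUA hBy hCz
    exact ⟨P, l, hP, hlpos.le, h1, Or.inl ⟨h2, h3⟩⟩
  · rw [h] at hBy
    obtain ⟨P, hP, h1, h2, h3⟩ :=
      exists_unitary_standard_triple hn hU hij hlpos hz rfl haj ha0 hUA hCz hBy
    exact ⟨P, l, hP, hlpos.le, h1, Or.inr ⟨h2, h3⟩⟩

lemma diagEmbed_mul {n : ℕ} (hn : 2 ≤ n) (M N : Matrix (Fin 2) (Fin 2) ℂ) :
    (diagEmbed M * diagEmbed N : Matrix (Fin n) (Fin n) ℂ) = diagEmbed (M * N) := by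
  obtain ⟨k, rfl⟩ := Nat.exists_eq_add_of_le' hn
  refine eq_diagEmbed hn ?_ ?_ ?_ ?_ ?_ ?_
  case refine_5 =>
    intro i j hi
    rw [Matrix.mul_apply]
    refine Finset.sum_eq_zero fun t _ => ?_
    rw [diagEmbed, dif_neg (by omega), zero_mul]
  case refine_6 =>
    intro i j hj
    rw [Matrix.mul_apply]
    refine Finset.sum_eq_zero fun t _ => ?_
    rw [diagEmbed, diagEmbed, dif_neg (c := t.val < 2 ∧ j.val < 2) (by omega), mul_zero]
  all_goals
    rw [Matrix.mul_apply, Fin.sum_univ_succ, Fin.sum_univ_succ]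
    simp [diagEmbed, Matrix.mul_apply]

lemma mcomm_diagEmbed {n : ℕ} (hn : 2 ≤ n) (M N : Matrix (Fin 2) (Fin 2) ℂ) :
    (mcomm (diagEmbed M) (diagEmbed N) : Matrix (Fin n) (Fin n) ℂ) = diagEmbed (mcomm M N) := by
  rw [mcomm, diagEmbed_mul hn, diagEmbed_mul hn]
  ext i j
  simp only [diagEmbed, mcomm, Matrix.sub_apply]
  split_ifs <;> simp

lemma frobSq_diagEmbed {n : ℕ} (hn : 2 ≤ n) (M : Matrix (Fin 2) (Fin 2) ℂ) :
    frobSq (diagEmbed M : Matrix (Fin n) (Fin n) ℂ) = frobSq M := by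
  obtain ⟨k, rfl⟩ := Nat.exists_eq_add_of_le' hn
  rw [frobSq_eq_sum, frobSq_eq_sum]
  simp [Fin.sum_univ_succ, diagEmbed]

lemma standard_triple_norms (l : ℝ) :
    frobSq (H1 l) = 2 * l ^ 2 ∧ frobSq (H2 l) = 2 * l ^ 2 ∧ frobSq (H3 l) = 2 * l ^ 2 ∧
      frobSq (mcomm (H1 l) (H2 l)) = 8 * l ^ 4 ∧ frobSq (mcomm (H1 l) (H3 l)) = 8 * l ^ 4 ∧
      frobSq (mcomm (H2 l) (H3 l)) = 8 * l ^ 4 := by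
  refine ⟨?_, ?_, ?_, ?_, ?_, ?_⟩ <;>
    simp [frobSq_eq_sum, mcomm, H1, H2, H3, Fin.sum_univ_two, Complex.normSq_apply] <;>
    ring

theorem ddvv_hermitian_equality (n m : ℕ) (hn : 2 ≤ n) (hm : 3 ≤ m)
    (B : Fin m → Matrix (Fin n) (Fin n) ℂ) (hB : ∀ r, (B r)ᴴ = B r) :
    (∑ r : Fin m, ∑ s : Fin m, frobSq (mcomm (B r) (B s)) =
        (4 / 3) * (∑ r : Fin m, frobSq (B r)) ^ 2) ↔
      ∃ (P : Matrix (Fin n) (Fin n) ℂ) (R : Matrix (Fin m) (Fin m) ℝ) (l : ℝ)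
        (r₁ r₂ r₃ : Fin m), Pᴴ * P = 1 ∧ Rᵀ * R = 1 ∧ 0 ≤ l ∧
        r₁ ≠ r₂ ∧ r₁ ≠ r₃ ∧ r₂ ≠ r₃ ∧
        (∑ j : Fin m, (R j r₁ : ℂ) • (Pᴴ * B j * P)) = diagEmbed (H1 l) ∧
        (∑ j : Fin m, (R j r₂ : ℂ) • (Pᴴ * B j * P)) = diagEmbed (H2 l) ∧
        (∑ j : Fin m, (R j r₃ : ℂ) • (Pᴴ * B j * P)) = diagEmbed (H3 l) ∧
        ∀ r : Fin m, r ≠ r₁ → r ≠ r₂ → r ≠ r₃ →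
          (∑ j : Fin m, (R j r : ℂ) • (Pᴴ * B j * P)) = 0 := by
  constructor
  · intro heq
    set G : Matrix (Fin m) (Fin m) ℝ := Matrix.of fun r s => frobInner (B r) (B s) with hG
    have hGs : Gᴴ = G := by
      ext r s
      simp [hG, frobInner_comm (B r)]
    obtain ⟨R, g, hR, hRG⟩ := exists_unitary_diagonal hGs
    rw [Matrix.conjTranspose_eq_transpose_of_trivial] at hR hRG
    set X : Fin m → Matrix (Fin n) (Fin n) ℂ := fun r => ∑ j, (R j r : ℂ) • B j with hX
    have hXh : ∀ r, (X r)ᴴ = X r := fun r => by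
      simp [hX, Matrix.conjTranspose_sum, hB]
    have horth : ∀ r s, r ≠ s → frobInner (X r) (X s) = 0 := by
      intro r s hrs
      have h : (Rᵀ * G * R) r s = 0 := by rw [hRG, Matrix.diagonal_apply_ne _ hrs]
      rw [← h, hX, Matrix.mul_assoc, frobInner_sum_smul_left]
      simp only [frobInner_sum_smul_right, Matrix.mul_apply, Matrix.transpose_apply, hG, Matrix.of_apply]
      exact Finset.sum_congr rfl fun j _ => by
        congr 1
        exact Finset.sum_congr rfl fun k _ => mul_comm _ _
    rw [← sum_frobSq_mcomm_orthogonal hR, ← sum_frobSq_orthogonal hR] at heq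
    obtain ⟨p, q, r, x, hpq, hpr, hqr, hp, hq, hr, hz, hc1, hc2⟩ :=
      exists_triple_of_equality hm hXh horth heq
    obtain ⟨P, l, hP, hl, h1, h23⟩ := exists_standard_triple hn (hXh p) (hXh q) (hXh r) hp hq hr
      (horth q r hqr) hc1 hc2
    have hconj : ∀ s, ∑ j, (R j s : ℂ) • (Pᴴ * B j * P) = Pᴴ * X s * P := by
      intro s
      simp [hX, Finset.mul_sum, Finset.sum_mul]
    have hz' : ∀ s, s ≠ p → s ≠ q → s ≠ r → ∑ j, (R j s : ℂ) • (Pᴴ * B j * P) = 0 := by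
      intro s a b c
      rw [hconj, hz s a b c, Matrix.mul_zero, Matrix.zero_mul]
    rcases h23 with ⟨h2, h3⟩ | ⟨h2, h3⟩
    · exact ⟨P, R, l, p, q, r, hP, hR, hl, hpq, hpr, hqr, (hconj p).trans h1,
        (hconj q).trans h2, (hconj r).trans h3, hz'⟩
    · exact ⟨P, R, l, p, r, q, hP, hR, hl, hpr, hpq, hqr.symm, (hconj p).trans h1,
        (hconj r).trans h2, (hconj q).trans h3, fun s a b c => hz' s a c b⟩
  · rintro ⟨P, R, l, p, q, r, hP, hR, -, hpq, hpr, hqr, h1, h2, h3, hz⟩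
    set D : Fin m → Matrix (Fin n) (Fin n) ℂ :=
      fun s => ∑ j, (R j s : ℂ) • (Pᴴ * B j * P) with hD
    have hs1 : ∑ s, frobSq (B s) = ∑ s, frobSq (D s) := by
      rw [hD, sum_frobSq_orthogonal hR]
      simp only [frobSq_conj hP]
    have hs2 : ∑ s, ∑ t, frobSq (mcomm (B s) (B t)) = ∑ s, ∑ t, frobSq (mcomm (D s) (D t)) := by
      rw [hD, sum_frobSq_mcomm_orthogonal hR]
      simp only [mcomm_conj hP, frobSq_conj hP]
    replace h1 : D p = _ := h1
    replace h2 : D q = _ := h2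
    replace h3 : D r = _ := h3
    replace hz : ∀ s, s ≠ p → s ≠ q → s ≠ r → D s = 0 := hz
    have hrow : ∀ s, ∑ t, frobSq (mcomm (D s) (D t)) = frobSq (mcomm (D s) (D p)) +
        frobSq (mcomm (D s) (D q)) + frobSq (mcomm (D s) (D r)) := fun s =>
      sum_eq_three hpq hpr hqr fun t a b c => by simp [hz t a b c, mcomm]
    obtain ⟨n1, n2, n3, c12, c13, c23⟩ := standard_triple_norms l
    rw [hs1, hs2, sum_eq_three (g := fun s => frobSq (D s)) hpq hpr hqr
        fun s a b c => by simp [hz s a b c],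
      sum_eq_three hpq hpr hqr fun s a b c => by simp [hz s a b c, mcomm], hrow, hrow, hrow]
    simp only [mcomm_self, frobSq_zero]
    rw [frobSq_mcomm_comm (D q) (D p), frobSq_mcomm_comm (D r) (D p),
      frobSq_mcomm_comm (D r) (D q), h1, h2, h3]
    simp only [mcomm_diagEmbed hn, frobSq_diagEmbed hn, n1, n2, n3, c12, c13, c23]
    ring
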